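/- Let h be the tensor Haar trace on the Brown algebra U_n^nc (the unique tracial state with φ ⋆_T h = h = h ⋆_T φ for all tracial states φ). Fix r ≥ 1, indices i_1,j_1,…,i_r,j_r ∈ {1,…,n} and ε_1,…,ε_r ∈ {∅,*}, and for k ∈ ℤ set S_k = { l ∈ {1,…,r} : k = #{m > l : ε_m = ∅} − #{m ≥ l : ε_m = *} }. If #{m : ε_m = *} ≠ #{m : ε_m = ∅}, then h(u_{i_1 j_1}^{ε_1} ⋯ u_{i_r j_r}^{ε_r}) = 0. If #{m : ε_m = *} = #{m : ε_m = ∅}, then h(u_{i_1 j_1}^{ε_1} ⋯ u_{i_r j_r}^{ε_r}) = ∏_{k=−r}^{r} h( ∏→_{l ∈ S_k} u_{i_l j_l}^{ε_l} ), where ∏→ denotes the product taken in increasing order of l and empty products equal 1. -/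

import Mathlib

noncomputable section

/-- A state on a unital `⋆`-algebra over `ℂ`. -/
def IsState {A : Type} [Ring A] [Algebra ℂ A] [StarRing A]
    (φ : A →ₗ[ℂ] ℂ) : Prop :=
  φ 1 = 1 ∧ ∀ a : A, 0 ≤ (φ (star a * a)).re ∧ (φ (star a * a)).im = 0

/-- A tracial state. -/
def IsTracialState {A : Type} [Ring A] [Algebra ℂ A] [StarRing A]
    (φ : A →ₗ[ℂ] ℂ) : Prop :=
  IsState φ ∧ ∀ a b : A, φ (a * b) = φ (b * a)

/-- The Brown algebra `U_n^nc`: a unital `⋆`-algebra generated by `n²` elements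
`u i j` subject to the unitarity relations, together with its universal property. -/
structure BrownAlg (n : ℕ) where
  carrier : Type
  [ring : Ring carrier]
  [algebra : Algebra ℂ carrier]
  [starRing : StarRing carrier]
  [starModule : StarModule ℂ carrier]
  u : Fin n → Fin n → carrier
  rel_left : ∀ i j, (∑ k, star (u k i) * u k j) = if i = j then 1 else 0
  rel_right : ∀ i j, (∑ k, u i k * star (u j k)) = if i = j then 1 else 0
  universal : ∀ (C : Type) [Ring C] [Algebra ℂ C] [StarRing C] [StarModule ℂ C]
      (v : Fin n → Fin n → C),
      (∀ i j, (∑ k, star (v k i) * v k j) = if i = j then 1 else 0) →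
      (∀ i j, (∑ k, v i k * star (v j k)) = if i = j then 1 else 0) →
      ∃! f : carrier →⋆ₐ[ℂ] C, ∀ i j, f (u i j) = v i j

attribute [instance] BrownAlg.ring BrownAlg.algebra BrownAlg.starRing BrownAlg.starModule

/-- The free product (coproduct) of two unital `⋆`-algebras over `ℂ`,
presented through its universal property. -/
structure FreeProd (A B : Type) [Ring A] [Algebra ℂ A] [StarRing A]
    [Ring B] [Algebra ℂ B] [StarRing B] where
  carrier : Type
  [ring : Ring carrier]
  [algebra : Algebra ℂ carrier]
  [starRing : StarRing carrier]
  [starModule : StarModule ℂ carrier]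
  inl : A →⋆ₐ[ℂ] carrier
  inr : B →⋆ₐ[ℂ] carrier
  universal : ∀ (D : Type) [Ring D] [Algebra ℂ D] [StarRing D] [StarModule ℂ D]
      (f : A →⋆ₐ[ℂ] D) (g : B →⋆ₐ[ℂ] D),
      ∃! h : carrier →⋆ₐ[ℂ] D, (∀ a, h (inl a) = f a) ∧ (∀ b, h (inr b) = g b)

attribute [instance] FreeProd.ring FreeProd.algebra FreeProd.starRing FreeProd.starModule

namespace FreeProd

variable {A B : Type} [Ring A] [Algebra ℂ A] [StarRing A]
    [Ring B] [Algebra ℂ B] [StarRing B]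

/-- The canonical embedding of a tagged element into the free product. -/
def embed (F : FreeProd A B) : A ⊕ B → F.carrier :=
  Sum.elim (fun a => F.inl a) (fun b => F.inr b)

/-- `Ψ` is the free product functional of `φ` and `ψ` on the free product `F`:
it is unital, restricts to `φ` and `ψ` on the two legs, and vanishes on alternating
products of centered elements. -/
def IsFreeProdFunctional (F : FreeProd A B) (φ : A →ₗ[ℂ] ℂ) (ψ : B →ₗ[ℂ] ℂ)
    (Ψ : F.carrier →ₗ[ℂ] ℂ) : Prop :=
  Ψ 1 = 1 ∧ (∀ a, Ψ (F.inl a) = φ a) ∧ (∀ b, Ψ (F.inr b) = ψ b) ∧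
  ∀ l : List (A ⊕ B), l ≠ [] →
    l.Chain' (fun x y => x.isLeft ≠ y.isLeft) →
    (∀ x ∈ l, Sum.elim (fun a => φ a = 0) (fun b => ψ b = 0) x) →
    Ψ ((l.map F.embed).prod) = 0

end FreeProd

section ProdFunctionals

variable {A : Type} [Ring A] [Algebra ℂ A] [StarRing A]

/-- `Ψ` is the tensor (tensor-independent) product functional of `φ` and `ψ`
relative to the counit `δc`. -/
def IsTensorProdFunctional (F : FreeProd A A) (δc : A →⋆ₐ[ℂ] ℂ)
    (φ ψ : A →ₗ[ℂ] ℂ) (Ψ : F.carrier →ₗ[ℂ] ℂ) : Prop :=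
  Ψ 1 = 1 ∧
  ∀ l : List (A ⊕ A), l ≠ [] →
    l.Chain' (fun x y => x.isLeft ≠ y.isLeft) →
    (∀ x ∈ l, Sum.elim (fun a => δc a = 0) (fun b => δc b = 0) x) →
    Ψ ((l.map F.embed).prod) =
      φ (l.filterMap Sum.getLeft?).prod * ψ (l.filterMap Sum.getRight?).prod

/-- `Ψ` is the boolean product functional of `φ` and `ψ` relative to the counit `δc`. -/
def IsBooleanProdFunctional (F : FreeProd A A) (δc : A →⋆ₐ[ℂ] ℂ)
    (φ ψ : A →ₗ[ℂ] ℂ) (Ψ : F.carrier →ₗ[ℂ] ℂ) : Prop :=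
  Ψ 1 = 1 ∧
  ∀ l : List (A ⊕ A), l ≠ [] →
    l.Chain' (fun x y => x.isLeft ≠ y.isLeft) →
    (∀ x ∈ l, Sum.elim (fun a => δc a = 0) (fun b => δc b = 0) x) →
    Ψ ((l.map F.embed).prod) = (l.map (Sum.elim (fun a => φ a) (fun b => ψ b))).prod

/-- `Ψ` is the monotone product functional of `φ` and `ψ` relative to the counit `δc`. -/
def IsMonotoneProdFunctional (F : FreeProd A A) (δc : A →⋆ₐ[ℂ] ℂ)
    (φ ψ : A →ₗ[ℂ] ℂ) (Ψ : F.carrier →ₗ[ℂ] ℂ) : Prop :=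
  Ψ 1 = 1 ∧
  ∀ l : List (A ⊕ A), l ≠ [] →
    l.Chain' (fun x y => x.isLeft ≠ y.isLeft) →
    (∀ x ∈ l, Sum.elim (fun a => δc a = 0) (fun b => δc b = 0) x) →
    Ψ ((l.map F.embed).prod) =
      φ (l.filterMap Sum.getLeft?).prod * ((l.filterMap Sum.getRight?).map (fun b => ψ b)).prod

/-- `Ψ` is the anti-monotone product functional of `φ` and `ψ` relative to the counit `δc`. -/
def IsAntiMonotoneProdFunctional (F : FreeProd A A) (δc : A →⋆ₐ[ℂ] ℂ)
    (φ ψ : A →ₗ[ℂ] ℂ) (Ψ : F.carrier →ₗ[ℂ] ℂ) : Prop :=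
  Ψ 1 = 1 ∧
  ∀ l : List (A ⊕ A), l ≠ [] →
    l.Chain' (fun x y => x.isLeft ≠ y.isLeft) →
    (∀ x ∈ l, Sum.elim (fun a => δc a = 0) (fun b => δc b = 0) x) →
    Ψ ((l.map F.embed).prod) =
      ((l.filterMap Sum.getLeft?).map (fun a => φ a)).prod * ψ (l.filterMap Sum.getRight?).prod

end ProdFunctionals

namespace BrownAlg

variable {n : ℕ}

/-- `Δ` is the coproduct of the unitary dual group `U⟨n⟩`. -/
def IsCoprod (U : BrownAlg n) (F : FreeProd U.carrier U.carrier)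
    (Δ : U.carrier →⋆ₐ[ℂ] F.carrier) : Prop :=
  ∀ i j, Δ (U.u i j) = ∑ k, F.inl (U.u i k) * F.inr (U.u k j)

/-- `δc` is the counit of the unitary dual group `U⟨n⟩`. -/
def IsCounit (U : BrownAlg n) (δc : U.carrier →⋆ₐ[ℂ] ℂ) : Prop :=
  ∀ i j, δc (U.u i j) = if i = j then 1 else 0

/-- `Σ` is the antipode of the unitary dual group `U⟨n⟩`. -/
def IsAntipode (U : BrownAlg n) (Sa : U.carrier →⋆ₐ[ℂ] U.carrier) : Prop :=
  ∀ i j, Sa (U.u i j) = star (U.u j i)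

/-- `χ = φ ⋆_F ψ`, the free convolution of the states `φ` and `ψ` on `U⟨n⟩`. -/
def FreeConv (U : BrownAlg n) (F : FreeProd U.carrier U.carrier)
    (Δ : U.carrier →⋆ₐ[ℂ] F.carrier) (φ ψ χ : U.carrier →ₗ[ℂ] ℂ) : Prop :=
  ∃ Ψ : F.carrier →ₗ[ℂ] ℂ, F.IsFreeProdFunctional φ ψ Ψ ∧ ∀ a, Ψ (Δ a) = χ a

/-- `χ = φ ⋆_T ψ`, the tensor convolution of the states `φ` and `ψ` on `U⟨n⟩`. -/
def TensorConv (U : BrownAlg n) (F : FreeProd U.carrier U.carrier)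
    (Δ : U.carrier →⋆ₐ[ℂ] F.carrier) (δc : U.carrier →⋆ₐ[ℂ] ℂ)
    (φ ψ χ : U.carrier →ₗ[ℂ] ℂ) : Prop :=
  ∃ Ψ : F.carrier →ₗ[ℂ] ℂ, IsTensorProdFunctional F δc φ ψ Ψ ∧ ∀ a, Ψ (Δ a) = χ a

/-- `χ = φ ⋆_B ψ`, the boolean convolution. -/
def BooleanConv (U : BrownAlg n) (F : FreeProd U.carrier U.carrier)
    (Δ : U.carrier →⋆ₐ[ℂ] F.carrier) (δc : U.carrier →⋆ₐ[ℂ] ℂ)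
    (φ ψ χ : U.carrier →ₗ[ℂ] ℂ) : Prop :=
  ∃ Ψ : F.carrier →ₗ[ℂ] ℂ, IsBooleanProdFunctional F δc φ ψ Ψ ∧ ∀ a, Ψ (Δ a) = χ a

/-- `χ = φ ⋆_M ψ`, the monotone convolution. -/
def MonotoneConv (U : BrownAlg n) (F : FreeProd U.carrier U.carrier)
    (Δ : U.carrier →⋆ₐ[ℂ] F.carrier) (δc : U.carrier →⋆ₐ[ℂ] ℂ)
    (φ ψ χ : U.carrier →ₗ[ℂ] ℂ) : Prop :=
  ∃ Ψ : F.carrier →ₗ[ℂ] ℂ, IsMonotoneProdFunctional F δc φ ψ Ψ ∧ ∀ a, Ψ (Δ a) = χ a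

/-- `χ = φ ⋆_AM ψ`, the anti-monotone convolution. -/
def AntiMonotoneConv (U : BrownAlg n) (F : FreeProd U.carrier U.carrier)
    (Δ : U.carrier →⋆ₐ[ℂ] F.carrier) (δc : U.carrier →⋆ₐ[ℂ] ℂ)
    (φ ψ χ : U.carrier →ₗ[ℂ] ℂ) : Prop :=
  ∃ Ψ : F.carrier →ₗ[ℂ] ℂ, IsAntiMonotoneProdFunctional F δc φ ψ Ψ ∧ ∀ a, Ψ (Δ a) = χ a

end BrownAlg

/-- A word in the generators `u_{ij}` and their adjoints, prescribed by a star pattern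
`ε` (`true` = star) and index patterns `i`, `j` (read `0`-based, of length `r`). -/
def genWord {n : ℕ} (U : BrownAlg n) (r : ℕ) (ε : ℕ → Bool) (i j : ℕ → Fin n) :
    List U.carrier :=
  (List.range r).map (fun m => if ε m then star (U.u (i m) (j m)) else U.u (i m) (j m))

/-- The set `S_k = {l : k = #{m > l : ε_m = ∅} − #{m ≥ l : ε_m = *}}` (indices read
`0`-based, ranging over `{0, …, r-1}`). -/
def levelSet (r : ℕ) (ε : ℕ → Bool) (k : ℤ) : Finset ℕ :=
  (Finset.range r).filter (fun l =>
    k = (((Finset.Ico (l + 1) r).filter (fun m => ε m = false)).card : ℤ)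
      - (((Finset.Ico l r).filter (fun m => ε m = true)).card : ℤ))


/-- A tensor product functional factorizes on all products of elements of the two legs, whether or
not the factors alternate or are annihilated by the counit. -/
lemma IsTensorProdFunctional.apply_prod_append {A : Type} [Ring A] [Algebra ℂ A] [StarRing A]
    {F : FreeProd A A} {δc : A →⋆ₐ[ℂ] ℂ} {φ ψ : A →ₗ[ℂ] ℂ} {Ψ : F.carrier →ₗ[ℂ] ℂ}
    (hΨ : IsTensorProdFunctional F δc φ ψ Ψ) (hφ : φ 1 = 1) (hψ : ψ 1 = 1)
    (l₁ l₂ : List (A ⊕ A)) (hchain : l₁.IsChain (fun x y => x.isLeft ≠ y.isLeft))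
    (hker : ∀ x ∈ l₁, Sum.elim (fun a => δc a = 0) (fun b => δc b = 0) x) :
    Ψ (((l₁ ++ l₂).map F.embed).prod) =
      φ ((l₁ ++ l₂).filterMap Sum.getLeft?).prod *
        ψ ((l₁ ++ l₂).filterMap Sum.getRight?).prod := by
  rcases l₂ with _ | ⟨x, l₂⟩
  · rw [List.append_nil]
    rcases eq_or_ne l₁ [] with rfl | hne
    · simp [hΨ.1, hφ, hψ]
    · exact hΨ.2 l₁ hne hchain hker
  by_cases hsame : ∃ l y, l₁ = l ++ [y] ∧ y.isLeft = x.isLeft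
  · obtain ⟨l, y, hly, hyx⟩ := hsame
    have hlen : l₁.length = l.length + 1 := by simp [hly]
    rw [hly] at hchain hker ⊢
    have hl : l.IsChain (fun x y => x.isLeft ≠ y.isLeft) := (List.isChain_append.1 hchain).1
    have hlker : ∀ x ∈ l, Sum.elim (fun a => δc a = 0) (fun b => δc b = 0) x :=
      fun z hz => hker z (by simp [hz])
    rcases y with y | y <;> rcases x with x | x <;> simp at hyx
    · have := hΨ.apply_prod_append hφ hψ l (Sum.inl (y * x) :: l₂) hl hlker
      simpa [FreeProd.embed, mul_assoc, List.filterMap_cons] using this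
    · have := hΨ.apply_prod_append hφ hψ l (Sum.inr (y * x) :: l₂) hl hlker
      simpa [FreeProd.embed, mul_assoc, List.filterMap_cons] using this
  · have hc : ∀ z : A ⊕ A, z.isLeft = x.isLeft →
        (l₁ ++ [z]).IsChain (fun x y => x.isLeft ≠ y.isLeft) := by
      intro z hz
      refine List.isChain_append.2 ⟨hchain, by simp, ?_⟩
      intro y hy w hw hyw
      simp only [List.head?_cons, Option.mem_def, Option.some.injEq] at hw
      subst hw
      refine hsame ⟨l₁.dropLast, y, ?_, by rw [hyw, hz]⟩
      exact (List.dropLast_append_getLast? y hy).symm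
    have hdrop := hΨ.apply_prod_append hφ hψ l₁ l₂ hchain hker
    rcases x with x | x
    · have hcent := hΨ.apply_prod_append hφ hψ
        (l₁ ++ [Sum.inl (x - algebraMap ℂ A (δc x))]) l₂ (hc _ rfl) (by
          intro z hz
          rcases List.mem_append.1 hz with hz | hz
          · exact hker z hz
          · simp only [List.mem_singleton] at hz
            subst hz
            simp [AlgHomClass.commutes])
      simp only [List.map_append, List.map_cons, List.map_nil, List.prod_append, List.prod_cons,
        List.prod_nil, List.filterMap_append, List.filterMap_cons, List.filterMap_nil,
        FreeProd.embed, Sum.elim_inl, Sum.getLeft?_inl, Sum.getRight?_inl, map_sub,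
        map_one, mul_one, List.append_nil, Algebra.algebraMap_eq_smul_one,
        mul_sub, sub_mul, mul_smul_comm, smul_mul_assoc, map_smul, smul_eq_mul,
        mul_assoc] at hcent hdrop ⊢
      linear_combination hcent + δc x * hdrop
    · have hcent := hΨ.apply_prod_append hφ hψ
        (l₁ ++ [Sum.inr (x - algebraMap ℂ A (δc x))]) l₂ (hc _ rfl) (by
          intro z hz
          rcases List.mem_append.1 hz with hz | hz
          · exact hker z hz
          · simp only [List.mem_singleton] at hz
            subst hz
            simp [AlgHomClass.commutes])
      simp only [List.map_append, List.map_cons, List.map_nil, List.prod_append, List.prod_cons,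
        List.prod_nil, List.filterMap_append, List.filterMap_cons, List.filterMap_nil,
        FreeProd.embed, Sum.elim_inr, Sum.getLeft?_inr, Sum.getRight?_inr, map_sub,
        map_one, mul_one, List.append_nil, Algebra.algebraMap_eq_smul_one,
        mul_sub, sub_mul, mul_smul_comm, smul_mul_assoc, map_smul, smul_eq_mul,
        mul_assoc] at hcent hdrop ⊢
      linear_combination hcent + δc x * hdrop
termination_by l₁.length + 2 * l₂.length
decreasing_by all_goals simp <;> omega

/-- A tensor product functional factorizes on arbitrary products of elements of the two legs. -/
lemma IsTensorProdFunctional.apply_prod {A : Type} [Ring A] [Algebra ℂ A] [StarRing A]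
    {F : FreeProd A A} {δc : A →⋆ₐ[ℂ] ℂ} {φ ψ : A →ₗ[ℂ] ℂ} {Ψ : F.carrier →ₗ[ℂ] ℂ}
    (hΨ : IsTensorProdFunctional F δc φ ψ Ψ) (hφ : φ 1 = 1) (hψ : ψ 1 = 1)
    (l : List (A ⊕ A)) :
    Ψ ((l.map F.embed).prod) =
      φ (l.filterMap Sum.getLeft?).prod * ψ (l.filterMap Sum.getRight?).prod :=
  hΨ.apply_prod_append hφ hψ [] l (by simp) (by simp)

/-- Extend a finite sequence by a default value. -/
def extendBy {α : Type*} {r : ℕ} (d : α) (k : Fin r → α) (l : ℕ) : α :=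
  if hl : l < r then k ⟨l, hl⟩ else d

/-- Distributivity of an ordered product over sums. -/
lemma prod_map_range_sum {R α : Type*} [Semiring R] [Fintype α] (d : α) (r : ℕ)
    (f : ℕ → α → R) :
    ((List.range r).map fun m => ∑ k, f m k).prod =
      ∑ k : Fin r → α, ((List.range r).map fun m => f m (extendBy d k m)).prod := by
  induction r with
  | zero => simp
  | succ r ih =>
    rw [← (Fin.snocEquiv fun _ : Fin (r + 1) => α).sum_comp, Fintype.sum_prod_type,
      Finset.sum_comm, List.range_succ, List.map_append, List.prod_append, ih,
      Finset.sum_mul]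
    refine Finset.sum_congr rfl fun k _ => ?_
    simp only [List.map_cons, List.map_nil, List.prod_cons, List.prod_nil, mul_one,
      Finset.mul_sum, List.map_append, List.prod_append]
    refine Finset.sum_congr rfl fun x _ => ?_
    congr 1
    · congr 1
      refine List.map_congr_left fun m hm => ?_
      have hm' : m < r := List.mem_range.1 hm
      have : (⟨m, Nat.lt_succ_of_lt hm'⟩ : Fin (r + 1)) = Fin.castSucc ⟨m, hm'⟩ := rfl
      simp [extendBy, hm', Nat.lt_succ_of_lt hm', Fin.snocEquiv, this, -Fin.castSucc_mk]
    · have : (⟨r, Nat.lt_succ_self r⟩ : Fin (r + 1)) = Fin.last r := rfl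
      simp [extendBy, Fin.snocEquiv, this]

/-- The tensor convolution of two unital functionals on words in the generators. -/
lemma BrownAlg.TensorConv.apply_genWord {n : ℕ} {U : BrownAlg n}
    {F : FreeProd U.carrier U.carrier} {Δ : U.carrier →⋆ₐ[ℂ] F.carrier}
    (hΔ : U.IsCoprod F Δ) {δc : U.carrier →⋆ₐ[ℂ] ℂ} {φ ψ χ : U.carrier →ₗ[ℂ] ℂ}
    (hconv : U.TensorConv F Δ δc φ ψ χ) (hφ : φ 1 = 1) (hψ : ψ 1 = 1)
    (d : Fin n) (r : ℕ) (ε : ℕ → Bool) (i j : ℕ → Fin n) :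
    χ (genWord U r ε i j).prod = ∑ k : Fin r → Fin n,
      φ (genWord U r ε i (extendBy d k)).prod * ψ (genWord U r ε (extendBy d k) j).prod := by
  obtain ⟨Ψ, hΨ, hχ⟩ := hconv
  let c : ℕ → Fin n → List (U.carrier ⊕ U.carrier) := fun m k =>
    if ε m then [Sum.inr (star (U.u k (j m))), Sum.inl (star (U.u (i m) k))]
    else [Sum.inl (U.u (i m) k), Sum.inr (U.u k (j m))]
  have hletter : ∀ m, Δ (if ε m then star (U.u (i m) (j m)) else U.u (i m) (j m)) =
      ∑ k, ((c m k).map F.embed).prod := by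
    intro m
    by_cases hε : ε m
    · simp [c, hε, FreeProd.embed, map_star, hΔ (i m) (j m), star_sum, star_mul]
    · simp [c, hε, FreeProd.embed, hΔ (i m) (j m)]
  have hlists : ∀ (k : ℕ → Fin n) (L : List ℕ),
      (L.map fun m => ((c m (k m)).map F.embed).prod).prod =
        ((L.flatMap fun m => c m (k m)).map F.embed).prod ∧
      (L.flatMap fun m => c m (k m)).filterMap Sum.getLeft? =
        L.map (fun m => if ε m then star (U.u (i m) (k m)) else U.u (i m) (k m)) ∧
      (L.flatMap fun m => c m (k m)).filterMap Sum.getRight? =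
        L.map (fun m => if ε m then star (U.u (k m) (j m)) else U.u (k m) (j m)) := by
    intro k L
    induction L with
    | nil => simp
    | cons m L ih =>
      obtain ⟨h₁, h₂, h₃⟩ := ih
      simp only [List.map_cons, List.prod_cons, List.flatMap_cons, List.map_append,
        List.prod_append, List.filterMap_append, h₁, h₂, h₃, true_and]
      by_cases hε : ε m <;> simp [c, hε, List.filterMap_cons]
  rw [← hχ, map_list_prod, genWord, List.map_map]
  have : (Δ ∘ fun m => if ε m then star (U.u (i m) (j m)) else U.u (i m) (j m)) =
      fun m => ∑ k, ((c m k).map F.embed).prod := funext hletter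
  rw [this, prod_map_range_sum d, map_sum]
  refine Finset.sum_congr rfl fun k _ => ?_
  obtain ⟨h₁, h₂, h₃⟩ := hlists (extendBy d k) (List.range r)
  rw [h₁, hΨ.apply_prod hφ hψ, h₂, h₃]
  rfl

/-- A list of Booleans with as many `true`s as `false`s is empty or has two distinct neighbours. -/
lemma exists_adjacent_not {b : List Bool} (hb : b.count true = b.count false) (hne : b ≠ []) :
    ∃ p x s, b = p ++ x :: (!x) :: s := by
  by_contra! hcon
  have hchain : b.IsChain (· = ·) := by
    rw [List.isChain_iff_forall_rel_of_append_cons_cons]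
    intro x y p s hb
    by_contra hxy
    have hy : y = !x := by cases x <;> cases y <;> simp_all
    exact hcon p x s (hy ▸ hb)
  rcases b with _ | ⟨x, b⟩
  · exact hne rfl
  rw [List.isChain_cons_eq_iff_eq_replicate] at hchain
  rw [hchain] at hb
  cases x <;> simp [List.count_replicate] at hb

/-- For each balanced star pattern, a unital functional is nonzero on some word of this pattern. -/
lemma exists_word_ne_zero {n : ℕ} (hn : 1 ≤ n) (U : BrownAlg n) (h : U.carrier →ₗ[ℂ] ℂ)
    (h1 : h 1 = 1) (b : List Bool) (hb : b.count true = b.count false) :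
    ∃ w : List (Bool × Fin n × Fin n), w.map Prod.fst = b ∧
      h (w.map fun x => if x.1 then star (U.u x.2.1 x.2.2) else U.u x.2.1 x.2.2).prod ≠ 0 := by
  rcases eq_or_ne b [] with rfl | hne
  · exact ⟨[], by simp [h1]⟩
  obtain ⟨p, x, s, rfl⟩ := exists_adjacent_not hb hne
  obtain ⟨w, hw, hw0⟩ := exists_word_ne_zero hn U h h1 (p ++ s) (by
    cases x <;> simp at hb ⊢ <;> omega)
  obtain ⟨wp, ws, rfl, rfl, rfl⟩ := List.map_eq_append_iff.1 hw
  let z : Fin n := ⟨0, hn⟩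
  let g : Bool → Fin n → Bool × Fin n × Fin n := fun y k => if x then (y, k, z) else (y, z, k)
  have hg : ∀ y k, (g y k).1 = y := by intro y k; cases x <;> rfl
  by_contra! hcon
  refine hw0 ?_
  have hone : (∑ k, (if x then star (U.u k z) * U.u k z else U.u z k * star (U.u z k))) =
      (1 : U.carrier) := by
    cases x
    · simpa using U.rel_right z z
    · simpa using U.rel_left z z
  rw [List.map_append, List.prod_append, ← one_mul (List.prod (List.map _ ws)), ← hone,
    Finset.sum_mul, Finset.mul_sum, map_sum]
  refine Finset.sum_eq_zero fun k _ => ?_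
  have := hcon (wp ++ g x k :: g (!x) k :: ws) (by simp [hg])
  rw [← this]
  cases x <;> simp [g, mul_assoc]
termination_by b.length
decreasing_by simp_all

/-- If a tracial state has product form on the words of a balanced star pattern, then it agrees
there with the Haar trace. -/
lemma haar_eq_of_product_form {n : ℕ} (hn : 1 ≤ n) {U : BrownAlg n}
    {F : FreeProd U.carrier U.carrier} {Δ : U.carrier →⋆ₐ[ℂ] F.carrier}
    (hΔ : U.IsCoprod F Δ) {δc : U.carrier →⋆ₐ[ℂ] ℂ}
    {h : U.carrier →ₗ[ℂ] ℂ} (htrace : IsTracialState h)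
    (hHaar : ∀ φ : U.carrier →ₗ[ℂ] ℂ, IsTracialState φ →
        U.TensorConv F Δ δc φ h h ∧ U.TensorConv F Δ δc h φ h)
    {φ : U.carrier →ₗ[ℂ] ℂ} (hφ : IsTracialState φ) {r : ℕ} {ε : ℕ → Bool}
    (hbal : ((List.range r).map ε).count true = ((List.range r).map ε).count false)
    {α β : (ℕ → Fin n) → ℂ} (hαβ : ∀ i j, φ (genWord U r ε i j).prod = α i * β j)
    (i j : ℕ → Fin n) :
    h (genWord U r ε i j).prod = φ (genWord U r ε i j).prod := by
  have h1 := htrace.1.1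
  have hφ1 := hφ.1.1
  let z : Fin n := ⟨0, hn⟩
  have hl := fun i j => (hHaar φ hφ).1.apply_genWord hΔ hφ1 h1 z r ε i j
  have hr := fun i j => (hHaar φ hφ).2.apply_genWord hΔ h1 hφ1 z r ε i j
  have hh := fun i j => (hHaar h htrace).1.apply_genWord hΔ h1 h1 z r ε i j
  simp only [hαβ] at hl hr ⊢
  obtain ⟨i₀, j₀, hne⟩ : ∃ i₀ j₀, h (genWord U r ε i₀ j₀).prod ≠ 0 := by
    obtain ⟨w, hw, hw0⟩ := exists_word_ne_zero hn U h h1 _ hbal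
    have hlen : w.length = r := by simpa using congrArg List.length hw
    refine ⟨fun l => (w.getD l (true, z, z)).2.1, fun l => (w.getD l (true, z, z)).2.2, ?_⟩
    convert hw0 using 3
    refine List.ext_getElem (by simp [genWord, hlen]) fun l hl₁ hl₂ => ?_
    have hlw : l < w.length := by simpa using hl₂
    have hε : ε l = w[l].1 := by
      have := List.getElem_of_eq hw (i := l) (by simpa using hlw)
      simpa using this.symm
    simp [genWord, hlw, hε]
  obtain ⟨A, hA⟩ : ∃ A : (ℕ → Fin n) → ℂ, ∀ i j, h (genWord U r ε i j).prod = A i * β j :=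
    ⟨fun i => ∑ k : Fin r → Fin n, h (genWord U r ε i (extendBy z k)).prod * α (extendBy z k),
      fun i j => by rw [hr i j]; simp_rw [← mul_assoc, ← Finset.sum_mul]⟩
  obtain ⟨B, hB⟩ : ∃ B : (ℕ → Fin n) → ℂ, ∀ i j, h (genWord U r ε i j).prod = α i * B j :=
    ⟨fun j => ∑ k : Fin r → Fin n, β (extendBy z k) * h (genWord U r ε (extendBy z k) j).prod,
      fun i j => by rw [hl i j]; simp_rw [mul_assoc, ← Finset.mul_sum]⟩
  have hβ : β j₀ ≠ 0 := fun h0 => hne (by rw [hA, h0, mul_zero])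
  obtain ⟨c, hc⟩ : ∃ c, ∀ i j, h (genWord U r ε i j).prod = c * (α i * β j) := by
    refine ⟨B j₀ / β j₀, fun i j => ?_⟩
    have := (hA i j₀).symm.trans (hB i j₀)
    rw [hA i j]
    field_simp
    linear_combination β j * this
  have hc0 : c ≠ 0 := fun h0 => hne (by rw [hc, h0, zero_mul])
  have hαβ0 : α i₀ * β j₀ ≠ 0 := fun h0 => hne (by rw [hc, h0, mul_zero])
  set S := ∑ k : Fin r → Fin n, β (extendBy z k) * α (extendBy z k) with hS
  have hr' : c * (α i₀ * β j₀) = c * (α i₀ * β j₀) * S := by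
    refine (hc i₀ j₀).symm.trans ((hr i₀ j₀).trans ?_)
    rw [hS, Finset.mul_sum]
    exact Finset.sum_congr rfl fun k _ => by rw [hc]; ring
  have hh' : c * (α i₀ * β j₀) = c * c * (α i₀ * β j₀) * S := by
    refine (hc i₀ j₀).symm.trans ((hh i₀ j₀).trans ?_)
    rw [hS, Finset.mul_sum]
    exact Finset.sum_congr rfl fun k _ => by rw [hc, hc]; ring
  have hS1 : S = 1 :=
    mul_left_cancel₀ (mul_ne_zero hc0 hαβ0) (by rw [mul_one, ← hr'])
  have hc1 : c = 1 := by
    rw [hS1] at hh'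
    have : c * (α i₀ * β j₀) * (c - 1) = 0 := by linear_combination -hh'
    rcases mul_eq_zero.1 this with h0 | h0
    · exact absurd h0 (mul_ne_zero hc0 hαβ0)
    · exact sub_eq_zero.1 h0
  rw [hc, hc1, one_mul]

section PiTensor

variable {κ ν : Type} [Fintype κ]

/-- The tensor product of a finite family of square matrices. -/
def piTensor (A : κ → Matrix ν ν ℂ) : Matrix (κ → ν) (κ → ν) ℂ :=
  Matrix.of fun x y => ∏ t, A t (x t) (y t)

lemma piTensor_one [DecidableEq ν] : piTensor (1 : κ → Matrix ν ν ℂ) = 1 := by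
  ext x y
  simp only [piTensor, Matrix.of_apply, Pi.one_apply, Matrix.one_apply]
  by_cases hxy : x = y
  · simp [hxy]
  · obtain ⟨t, ht⟩ := Function.ne_iff.1 hxy
    rw [if_neg hxy]
    exact Finset.prod_eq_zero (Finset.mem_univ t) (if_neg ht)

lemma piTensor_mul [DecidableEq κ] [Fintype ν] (A B : κ → Matrix ν ν ℂ) :
    piTensor A * piTensor B = piTensor (A * B) := by
  ext x y
  simp only [piTensor, Matrix.mul_apply, Matrix.of_apply, Pi.mul_apply, Finset.prod_univ_sum,
    Fintype.piFinset_univ, Finset.prod_mul_distrib]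

lemma trace_piTensor [DecidableEq κ] [Fintype ν] (A : κ → Matrix ν ν ℂ) :
    (piTensor A).trace = ∏ t, (A t).trace := by
  simp only [piTensor, Matrix.trace, Matrix.diag_apply, Matrix.of_apply, Finset.prod_univ_sum,
    Fintype.piFinset_univ]

lemma piTensor_mulSingle_apply [DecidableEq κ] [DecidableEq ν] (a : κ) (E : Matrix ν ν ℂ)
    (x y : κ → ν) :
    piTensor (Pi.mulSingle a E) x y =
      E (x a) (y a) * ∏ t ∈ Finset.univ.erase a, (1 : Matrix ν ν ℂ) (x t) (y t) := by
  rw [piTensor, Matrix.of_apply, ← Finset.mul_prod_erase _ _ (Finset.mem_univ a),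
    Pi.mulSingle_eq_same]
  congr 1
  exact Finset.prod_congr rfl fun t ht => by
    rw [Pi.mulSingle_eq_of_ne (Finset.ne_of_mem_erase ht)]

variable [DecidableEq κ] [DecidableEq ν]

lemma conjTranspose_piTensor_mulSingle (a : κ) (E : Matrix ν ν ℂ) :
    (piTensor (Pi.mulSingle a E)).conjTranspose = piTensor (Pi.mulSingle a E.conjTranspose) := by
  ext x y
  simp [piTensor_mulSingle_apply, Matrix.one_apply, star_prod, apply_ite, eq_comm]

lemma piTensor_mulSingle_zero (a : κ) :
    piTensor (Pi.mulSingle a (0 : Matrix ν ν ℂ)) = 0 := by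
  ext x y
  simp [piTensor_mulSingle_apply]

lemma sum_piTensor_mulSingle {ι : Type*} [Fintype ι] (a : κ) (E : ι → Matrix ν ν ℂ) :
    ∑ k, piTensor (Pi.mulSingle a (E k)) = piTensor (Pi.mulSingle a (∑ k, E k)) := by
  ext x y
  simp [piTensor_mulSingle_apply, Matrix.sum_apply, Finset.sum_mul]

lemma sum_piTensor_single_mul_single [Fintype ν] (a : κ) (i j : ν) :
    ∑ k, piTensor (Pi.mulSingle a (Matrix.single k i (1 : ℂ))) *
        piTensor (Pi.mulSingle a (Matrix.single j k (1 : ℂ))) = if i = j then 1 else 0 := by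
  simp only [piTensor_mul, ← Pi.mulSingle_mul]
  split_ifs with hij
  · subst hij
    simp only [Matrix.single_mul_single_same, mul_one, sum_piTensor_mulSingle,
      Matrix.sum_single_one, Pi.mulSingle_one, piTensor_one]
  · simp [Matrix.single_mul_single_of_ne _ _ _ _ hij, piTensor_mulSingle_zero]

open scoped ComplexOrder in
/-- The normalized trace on block matrices, composed with a `⋆`-homomorphism, is a tracial
state. -/
lemma isTracialState_blockTrace {A ξ : Type} [Ring A] [Algebra ℂ A] [StarRing A]
    [Fintype ξ] [DecidableEq ξ] [Nonempty κ] [Nonempty ξ]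
    (f : A →⋆ₐ[ℂ] Matrix κ κ (Matrix ξ ξ ℂ)) :
    IsTracialState (((Fintype.card κ * Fintype.card ξ : ℂ)⁻¹) •
      (Matrix.traceLinearMap ξ ℂ ℂ ∘ₗ Matrix.traceLinearMap κ ℂ (Matrix ξ ξ ℂ) ∘ₗ
        f.toAlgHom.toLinearMap)) := by
  have hκ : (Fintype.card κ : ℂ) ≠ 0 := by simp
  have hξ : (Fintype.card ξ : ℂ) ≠ 0 := by simp
  refine ⟨⟨?_, fun a => ?_⟩, fun a b => ?_⟩
  · simp only [LinearMap.smul_apply, LinearMap.comp_apply, AlgHom.toLinearMap_apply, map_one,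
      Matrix.traceLinearMap_apply, Matrix.trace_one, smul_eq_mul]
    rw [← nsmul_one (A := Matrix ξ ξ ℂ), Matrix.trace_smul, Matrix.trace_one, nsmul_eq_mul]
    field_simp
  · have hnn : 0 ≤ (star (f a) * f a).trace.trace := by
      rw [Matrix.trace.eq_def (star (f a) * f a), Matrix.trace_sum]
      refine Finset.sum_nonneg fun k _ => ?_
      rw [Matrix.diag_apply, Matrix.mul_apply, Matrix.trace_sum]
      exact Finset.sum_nonneg fun c _ => (Matrix.posSemidef_conjTranspose_mul_self _).trace_nonneg
    have hc : 0 ≤ (Fintype.card κ * Fintype.card ξ : ℂ)⁻¹ * (star (f a) * f a).trace.trace :=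
      mul_nonneg (by rw [← Nat.cast_mul]; positivity) hnn
    simp only [LinearMap.smul_apply, LinearMap.comp_apply, AlgHom.toLinearMap_apply,
      Matrix.traceLinearMap_apply, smul_eq_mul, StarAlgHom.coe_toAlgHom, map_mul, map_star]
    exact ⟨(Complex.nonneg_iff.1 hc).1, (Complex.nonneg_iff.1 hc).2.symm⟩
  · have : ∀ P Q : Matrix κ κ (Matrix ξ ξ ℂ), (P * Q).trace.trace = (Q * P).trace.trace := by
      intro P Q
      have hPQ : ∀ P Q : Matrix κ κ (Matrix ξ ξ ℂ),
          (P * Q).trace.trace = ∑ a, ∑ c, (P a c * Q c a).trace := fun P Q => by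
        simp only [Matrix.trace.eq_def (P * Q), Matrix.diag_apply, Matrix.mul_apply,
          Matrix.trace_sum]
      rw [hPQ, hPQ, Finset.sum_comm]
      exact Finset.sum_congr rfl fun a _ => Finset.sum_congr rfl fun c _ =>
        Matrix.trace_mul_comm _ _
    simp [map_mul, this (f a) (f b)]

end PiTensor

/-- The block matrices whose `(b + 1, b)` entry is the flip acting on the `b`-th tensor factor. -/
def shiftedFlip (n N : ℕ) [NeZero N] (i j : Fin n) :
    Matrix (ZMod N) (ZMod N) (Matrix (ZMod N → Fin n) (ZMod N → Fin n) ℂ) :=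
  Matrix.of fun a b => if a = b + 1 then piTensor (Pi.mulSingle b (Matrix.single j i 1)) else 0

lemma shiftedFlip_rel_left (n N : ℕ) [NeZero N] (i j : Fin n) :
    ∑ k, star (shiftedFlip n N k i) * shiftedFlip n N k j = if i = j then 1 else 0 := by
  ext1 a b
  have hentry : ∀ k, (star (shiftedFlip n N k i) * shiftedFlip n N k j) a b =
      if a = b then piTensor (Pi.mulSingle a (Matrix.single k i (1 : ℂ))) *
        piTensor (Pi.mulSingle a (Matrix.single j k (1 : ℂ))) else 0 := by
    intro k
    rw [Matrix.mul_apply, Finset.sum_eq_single (a + 1)]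
    · by_cases hab : a = b
      · subst hab
        simp [shiftedFlip, Matrix.star_apply, Matrix.star_eq_conjTranspose,
          conjTranspose_piTensor_mulSingle]
      · simp [shiftedFlip, hab]
    · intro c _ hc
      simp [shiftedFlip, Matrix.star_apply, hc]
    · simp
  rw [Matrix.sum_apply, Finset.sum_congr rfl fun k _ => hentry k]
  by_cases hab : a = b
  · simp only [hab, if_true, sum_piTensor_single_mul_single]
    split_ifs <;> simp
  · split_ifs <;> simp [hab]

lemma shiftedFlip_rel_right (n N : ℕ) [NeZero N] (i j : Fin n) :
    ∑ k, shiftedFlip n N i k * star (shiftedFlip n N j k) = if i = j then 1 else 0 := by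
  ext1 a b
  have hentry : ∀ k, (shiftedFlip n N i k * star (shiftedFlip n N j k)) a b =
      if a = b then piTensor (Pi.mulSingle (a - 1) (Matrix.single k i (1 : ℂ))) *
        piTensor (Pi.mulSingle (a - 1) (Matrix.single j k (1 : ℂ))) else 0 := by
    intro k
    rw [Matrix.mul_apply, Finset.sum_eq_single (a - 1)]
    · by_cases hab : a = b
      · subst hab
        simp [shiftedFlip, Matrix.star_apply, Matrix.star_eq_conjTranspose,
          conjTranspose_piTensor_mulSingle]
      · simp [shiftedFlip, Matrix.star_apply, hab, Ne.symm hab]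
    · intro c _ hc
      have : a ≠ c + 1 := fun h => hc (by rw [h, add_sub_cancel_right])
      simp [shiftedFlip, this]
    · simp
  rw [Matrix.sum_apply, Finset.sum_congr rfl fun k _ => hentry k]
  by_cases hab : a = b
  · simp only [hab, if_true, sum_piTensor_single_mul_single]
    split_ifs <;> simp
  · split_ifs <;> simp [hab]

/-- The number of unstarred minus the number of starred letters at the positions `l, …, r - 1`. -/
def suffixBalance (r : ℕ) (ε : ℕ → Bool) (l : ℕ) : ℤ :=
  ∑ m ∈ Finset.range r, (if ε m then (-1 : ℤ) else 1) -
    ∑ m ∈ Finset.range l, (if ε m then (-1 : ℤ) else 1)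

/-- The index `k` of the level set `S_k` containing a given position. -/
def letterLevel (r : ℕ) (ε : ℕ → Bool) (l : ℕ) : ℤ :=
  suffixBalance r ε (l + 1) - if ε l then 1 else 0

lemma suffixBalance_eq_succ_add (r : ℕ) (ε : ℕ → Bool) (l : ℕ) :
    suffixBalance r ε l = suffixBalance r ε (l + 1) + if ε l then -1 else 1 := by
  rw [suffixBalance, suffixBalance, Finset.sum_range_succ _ l]
  ring

/-- The matrix unit by which the flip represents a generator or its adjoint. -/
def letterUnit {n : ℕ} (ε : ℕ → Bool) (i j : ℕ → Fin n) (m : ℕ) : Matrix (Fin n) (Fin n) ℂ :=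
  if ε m then Matrix.single (i m) (j m) 1 else Matrix.single (j m) (i m) 1

lemma shiftedFlip_letter_apply {n N : ℕ} [NeZero N] (ε : ℕ → Bool) (i j : ℕ → Fin n) (m : ℕ)
    (a b : ZMod N) :
    (if ε m then star (shiftedFlip n N (i m) (j m)) else shiftedFlip n N (i m) (j m)) a b =
      if a = b + (if ε m then -1 else 1) then
        piTensor (Pi.mulSingle (b - if ε m then 1 else 0) (letterUnit ε i j m)) else 0 := by
  by_cases hε : ε m
  · by_cases hab : b = a + 1
    · subst hab
      simp [hε, shiftedFlip, letterUnit, Matrix.star_apply, Matrix.star_eq_conjTranspose,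
        conjTranspose_piTensor_mulSingle]
    · have : a ≠ b + -1 := fun h => hab (by rw [h]; ring)
      simp [hε, shiftedFlip, Matrix.star_apply, hab, this]
  · simp [hε, shiftedFlip, letterUnit]

lemma shiftedFlip_word_apply {n N : ℕ} [NeZero N] (r : ℕ) (ε : ℕ → Bool) (i j : ℕ → Fin n)
    (d l : ℕ) (hl : l + d = r) (a b : ZMod N) :
    (((List.range' l d).map fun m => if ε m then star (shiftedFlip n N (i m) (j m))
        else shiftedFlip n N (i m) (j m)).prod) a b =
      if a = b + (suffixBalance r ε l : ZMod N) then
        piTensor fun t => (((List.range' l d).filter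
          fun m => b + (letterLevel r ε m : ZMod N) = t).map (letterUnit ε i j)).prod
      else 0 := by
  induction d generalizing l a with
  | zero =>
    obtain rfl : l = r := hl
    simp only [List.range'_zero, List.map_nil, List.prod_nil, List.filter_nil, suffixBalance,
      sub_self, Int.cast_zero, add_zero, Matrix.one_apply]
    exact if_congr Iff.rfl piTensor_one.symm rfl
  | succ d ih =>
    have ih := ih (l + 1) (by omega)
    rw [List.range'_succ, List.map_cons, List.prod_cons, Matrix.mul_apply,
      Finset.sum_eq_single (b + (suffixBalance r ε (l + 1) : ZMod N))]
    · rw [ih, if_pos rfl, shiftedFlip_letter_apply, suffixBalance_eq_succ_add r ε l]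
      have hcast : (b + (suffixBalance r ε (l + 1) : ZMod N) + if ε l then -1 else 1) =
          b + ((suffixBalance r ε (l + 1) + if ε l then -1 else 1 : ℤ) : ZMod N) := by
        split_ifs <;> push_cast <;> ring
      rw [hcast, ite_mul, zero_mul, piTensor_mul]
      refine if_congr Iff.rfl (congrArg piTensor (funext fun t => ?_)) rfl
      have hsite : (b + (suffixBalance r ε (l + 1) : ZMod N) - if ε l then 1 else 0) =
          b + (letterLevel r ε l : ZMod N) := by
        rw [letterLevel]
        split_ifs <;> push_cast <;> ring
      rw [hsite, Pi.mul_apply, List.filter_cons]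
      by_cases ht : b + (letterLevel r ε l : ZMod N) = t
      · subst ht
        simp
      · simp [ht]
    · intro c _ hc
      rw [ih, if_neg hc, mul_zero]
    · simp

/-- The tracial state given by the shifted flips. -/
lemma exists_shiftedFlip_state {n : ℕ} (hn : 1 ≤ n) (U : BrownAlg n) (N : ℕ) [NeZero N] :
    ∃ φ : U.carrier →ₗ[ℂ] ℂ, IsTracialState φ ∧ ∀ r ε i j,
      φ (genWord U r ε i j).prod = if (suffixBalance r ε 0 : ZMod N) = 0 then
        ∏ t : ZMod N, ((n : ℂ)⁻¹ * (((List.range r).filter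
          fun m => (letterLevel r ε m : ZMod N) = t).map (letterUnit ε i j)).prod.trace)
      else 0 := by
  obtain ⟨f, hf, -⟩ := U.universal _ (shiftedFlip n N) (shiftedFlip_rel_left n N)
    (shiftedFlip_rel_right n N)
  have : Nonempty (Fin n) := ⟨⟨0, hn⟩⟩
  refine ⟨_, isTracialState_blockTrace f, fun r ε i j => ?_⟩
  have hfword : f (genWord U r ε i j).prod =
      ((List.range' 0 r).map fun m => if ε m then star (shiftedFlip n N (i m) (j m))
        else shiftedFlip n N (i m) (j m)).prod := by
    rw [map_list_prod, genWord, List.map_map, List.range_eq_range']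
    congr 2
    funext m
    simp only [Function.comp_apply, apply_ite f, map_star, hf]
  simp only [LinearMap.smul_apply, LinearMap.comp_apply, AlgHom.toLinearMap_apply,
    Matrix.traceLinearMap_apply, smul_eq_mul, StarAlgHom.coe_toAlgHom, hfword]
  rw [Matrix.trace.eq_def (List.prod _), Matrix.trace_sum]
  simp only [Matrix.diag_apply, shiftedFlip_word_apply r ε i j r 0 (zero_add r), left_eq_add]
  split_ifs with h0
  · have hshift : ∀ b : ZMod N, (piTensor fun t => (((List.range' 0 r).filter
        fun m => b + (letterLevel r ε m : ZMod N) = t).map (letterUnit ε i j)).prod).trace =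
        ∏ t : ZMod N, (((List.range r).filter
          fun m => (letterLevel r ε m : ZMod N) = t).map (letterUnit ε i j)).prod.trace := by
      intro b
      rw [trace_piTensor, ← Equiv.prod_comp (Equiv.addLeft b)]
      simp [List.range_eq_range']
    simp only [hshift, Finset.sum_const, Finset.card_univ, ZMod.card, nsmul_eq_mul,
      Finset.prod_mul_distrib, Finset.prod_const, Fintype.card_pi, Fintype.card_fin]
    have : (N : ℂ) ≠ 0 := by exact_mod_cast NeZero.ne N
    have : (n : ℂ) ≠ 0 := by exact_mod_cast (by omega : n ≠ 0)
    push_cast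
    rw [inv_pow]
    field_simp
  · simp

/-- A cyclically alternating list of Booleans. -/
def IsAlternating (b : List Bool) : Prop :=
  b.IsChain (· ≠ ·) ∧ ∀ x ∈ b.head?, ∀ y ∈ b.getLast?, x ≠ y

lemma IsAlternating.count_eq {b : List Bool} (hb : IsAlternating b) :
    b.count true = b.count false := by
  have key : ∀ (b : List Bool) (x : Bool), (x :: b).IsChain (· ≠ ·) →
      (x :: b).count x = (x :: b).count (!x) +
        if (x :: b).getLast (List.cons_ne_nil _ _) = x then 1 else 0 := by
    intro b
    induction b with
    | nil => intro x _; cases x <;> simp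
    | cons y b ih =>
      intro x hx
      rw [List.isChain_cons_cons] at hx
      have hy : y = !x := by cases x <;> cases y <;> simp_all
      have := ih y hx.2
      subst hy
      rw [List.getLast_cons (List.cons_ne_nil _ _), List.count_cons (a := x),
        List.count_cons (a := !x) (b := x)]
      generalize ((!x) :: b).getLast _ = z at *
      cases x <;> cases z <;> simp_all
  rcases b with _ | ⟨x, b⟩
  · rfl
  have hlast := hb.2 x (by simp) _ (List.getLast_mem_getLast? (List.cons_ne_nil x b))
  have := key b x hb.1
  rw [if_neg hlast.symm] at this
  cases x <;> simp_all

/-- A product of matrix units along an alternating list of letters. -/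
lemma exists_prod_letterUnit_eq {n : ℕ} (ε : ℕ → Bool) (L : List ℕ) (a : ℕ)
    (hchain : ((a :: L).map ε).IsChain (· ≠ ·)) :
    ∃ (z : ℕ) (α β : (ℕ → Fin n) → ℂ), (a :: L).getLast? = some z ∧
      ∀ i j, ((a :: L).map (letterUnit ε i j)).prod = (α i * β j) •
        Matrix.single (if ε a then i a else j a) (if ε z then j z else i z) (1 : ℂ) := by
  induction L generalizing a with
  | nil =>
    refine ⟨a, fun _ => 1, fun _ => 1, rfl, fun i j => ?_⟩
    by_cases ha : ε a <;> simp [letterUnit, ha]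
  | cons b L ih =>
    rw [List.map_cons, List.map_cons, List.isChain_cons_cons] at hchain
    obtain ⟨z, α, β, hz, hprod⟩ := ih b hchain.2
    have hab := hchain.1
    rcases hεa : ε a with _ | _
    · have hεb : ε b = true := by simpa [hεa] using hab.symm
      refine ⟨z, fun i => α i * if i a = i b then 1 else 0, β, by simpa using hz,
        fun i j => ?_⟩
      rw [List.map_cons, List.prod_cons, hprod]
      by_cases hi : i a = i b
      · simp [letterUnit, hεa, hεb, hi]
      · simp [letterUnit, hεa, hεb, hi, Matrix.single_mul_single_of_ne]
    · have hεb : ε b = false := by simpa [hεa] using hab.symm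
      refine ⟨z, α, fun j => β j * if j a = j b then 1 else 0, by simpa using hz,
        fun i j => ?_⟩
      rw [List.map_cons, List.prod_cons, hprod]
      by_cases hj : j a = j b
      · simp [letterUnit, hεa, hεb, hj]
      · simp [letterUnit, hεa, hεb, hj, Matrix.single_mul_single_of_ne]

/-- Along a cyclically alternating list of letters, the trace of the product of matrix units has
product form. -/
lemma exists_trace_prod_letterUnit_eq {n : ℕ} (ε : ℕ → Bool) (L : List ℕ)
    (hL : IsAlternating (L.map ε)) :
    ∃ α β : (ℕ → Fin n) → ℂ, ∀ i j, (L.map (letterUnit ε i j)).prod.trace = α i * β j := by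
  rcases L with _ | ⟨a, L⟩
  · exact ⟨fun _ => n, fun _ => 1, fun i j => by simp⟩
  obtain ⟨z, α, β, hz, hprod⟩ := exists_prod_letterUnit_eq (n := n) ε L a hL.1
  have haz : ε a ≠ ε z := hL.2 _ (by simp) _ (by rw [List.getLast?_map, hz]; simp)
  rcases hεa : ε a with _ | _
  · have hεz : ε z = true := by simpa [hεa] using haz.symm
    refine ⟨α, fun j => β j * if j a = j z then 1 else 0, fun i j => ?_⟩
    rw [hprod, Matrix.trace_smul]
    by_cases hj : j a = j z <;> simp [hεa, hεz, hj, Matrix.trace_single_eq_of_ne]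
  · have hεz : ε z = false := by simpa [hεa] using haz.symm
    refine ⟨fun i => α i * if i a = i z then 1 else 0, β, fun i j => ?_⟩
    rw [hprod, Matrix.trace_smul]
    by_cases hi : i a = i z <;> simp [hεa, hεz, hi, Matrix.trace_single_eq_of_ne]

lemma level_filter_chain (r : ℕ) (ε : ℕ → Bool) (k : ℤ) (d l : ℕ) (hl : l + d = r) :
    let L := (List.range' l d).filter fun m => letterLevel r ε m = k
    (L = [] → (k < suffixBalance r ε l ↔ k < 0)) ∧ (L.map ε).IsChain (· ≠ ·) ∧
      (∀ x ∈ (L.map ε).head?, (x = false ↔ k < suffixBalance r ε l)) ∧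
      ∀ x ∈ (L.map ε).getLast?, (x = true ↔ k < 0) := by
  induction d generalizing l with
  | zero =>
    obtain rfl : l = r := hl
    simp [suffixBalance]
  | succ d ih =>
    obtain ⟨h₁, h₂, h₃, h₄⟩ := ih (l + 1) (by omega)
    have hs := suffixBalance_eq_succ_add r ε l
    have hlev : letterLevel r ε l = suffixBalance r ε (l + 1) - if ε l then 1 else 0 := rfl
    rw [List.range'_succ, List.filter_cons]
    generalize (List.range' (l + 1) d).filter (fun m => letterLevel r ε m = k) = L at *
    by_cases hk : letterLevel r ε l = k
    · have hup : ε l = true ↔ k < suffixBalance r ε (l + 1) := by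
        split_ifs at hlev with hε <;> simp [hε] <;> omega
      have hdown : ε l = false ↔ k < suffixBalance r ε l := by
        split_ifs at hlev hs with hε <;> simp [hε] <;> omega
      simp only [hk, decide_true, if_true, List.map_cons]
      refine ⟨by simp, ?_, by simpa using hdown, ?_⟩
      · rw [List.isChain_cons]
        refine ⟨fun y hy hxy => ?_, h₂⟩
        have := h₃ y hy
        rw [← hxy, ← hup] at this
        cases hε : ε l <;> simp [hε] at this
      · rcases L with _ | ⟨b, L⟩
        · simpa [hup] using h₁ rfl
        · intro x hx
          exact h₄ x (by simpa using hx)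
    · have hsame : k < suffixBalance r ε l ↔ k < suffixBalance r ε (l + 1) := by
        split_ifs at hlev hs <;> omega
      simp only [hk, decide_false, Bool.false_eq_true, if_false, hsame]
      exact ⟨h₁, h₂, h₃, h₄⟩

/-- In a balanced word, the letters of each level alternate cyclically. -/
lemma isAlternating_level_filter {r : ℕ} {ε : ℕ → Bool} (hbal : suffixBalance r ε 0 = 0) (k : ℤ) :
    IsAlternating (((List.range r).filter fun m => letterLevel r ε m = k).map ε) := by
  obtain ⟨-, h₂, h₃, h₄⟩ := level_filter_chain r ε k r 0 (zero_add r)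
  rw [List.range_eq_range']
  refine ⟨h₂, fun x hx y hy hxy => ?_⟩
  have hx := h₃ x hx
  have hy := h₄ y hy
  rw [hbal] at hx
  subst hxy
  cases x <;> simp at hx hy <;> omega

lemma suffixBalance_eq_card_sub_card {r l : ℕ} (ε : ℕ → Bool) (hl : l ≤ r) :
    suffixBalance r ε l = (((Finset.Ico l r).filter fun m => ε m = false).card : ℤ) -
      ((Finset.Ico l r).filter fun m => ε m = true).card := by
  rw [suffixBalance, ← Finset.sum_Ico_eq_sub _ hl, Finset.sum_ite]
  simp
  ring

lemma letterLevel_eq_card_sub_card {r l : ℕ} (ε : ℕ → Bool) (hl : l < r) :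
    letterLevel r ε l = (((Finset.Ico (l + 1) r).filter fun m => ε m = false).card : ℤ) -
      ((Finset.Ico l r).filter fun m => ε m = true).card := by
  rw [letterLevel, suffixBalance_eq_card_sub_card ε (by omega : l + 1 ≤ r),
    ← Finset.insert_Ico_add_one_left_eq_Ico hl, Finset.filter_insert]
  by_cases hε : ε l
  · simp [hε]
    ring
  · simp [hε]

lemma abs_letterLevel_le {r l : ℕ} (ε : ℕ → Bool) (hl : l < r) : |letterLevel r ε l| ≤ r := by
  have h₁ := (Finset.card_filter_le (Finset.Ico (l + 1) r) fun m => ε m = false)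
  have h₂ := (Finset.card_filter_le (Finset.Ico l r) fun m => ε m = true)
  rw [Nat.card_Ico] at h₁ h₂
  rw [letterLevel_eq_card_sub_card ε hl, abs_le]
  omega

lemma abs_suffixBalance_zero_le (r : ℕ) (ε : ℕ → Bool) : |suffixBalance r ε 0| ≤ r := by
  have h₁ := (Finset.card_filter_le (Finset.Ico 0 r) fun m => ε m = false)
  have h₂ := (Finset.card_filter_le (Finset.Ico 0 r) fun m => ε m = true)
  rw [Nat.card_Ico] at h₁ h₂
  rw [suffixBalance_eq_card_sub_card ε (Nat.zero_le r), abs_le]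
  omega

lemma count_sub_count_eq_suffixBalance (r : ℕ) (ε : ℕ → Bool) :
    (((List.range r).map ε).count false : ℤ) - ((List.range r).map ε).count true =
      suffixBalance r ε 0 := by
  rw [suffixBalance, Finset.sum_range_zero, sub_zero]
  induction r with
  | zero => simp
  | succ r ih =>
    rw [Finset.sum_range_succ, ← ih, List.range_succ]
    cases hε : ε r <;> simp [hε] <;> ring

lemma sort_levelSet (r : ℕ) (ε : ℕ → Bool) (k : ℤ) :
    (levelSet r ε k).sort (· ≤ ·) = (List.range r).filter fun m => letterLevel r ε m = k := by
  have hfin : levelSet r ε k =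
      ((List.range r).filter fun m => letterLevel r ε m = k).toFinset := by
    ext l
    simp only [levelSet, Finset.mem_filter, Finset.mem_range, List.mem_toFinset, List.mem_filter,
      List.mem_range, decide_eq_true_eq]
    exact and_congr_right fun hl => by rw [letterLevel_eq_card_sub_card ε hl, eq_comm]
  rw [hfin]
  exact (List.toFinset_sort (· ≤ ·) (List.nodup_range.filter _)).2 (List.pairwise_le_range.filter _)

lemma intCast_zmod_eq_iff {r : ℕ} {a b : ℤ} (ha : |a| ≤ r) (hb : |b| ≤ r) :
    (a : ZMod (2 * r + 1)) = b ↔ a = b := by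
  refine ⟨fun hab => ?_, fun hab => by rw [hab]⟩
  rw [ZMod.intCast_eq_intCast_iff_dvd_sub] at hab
  rw [abs_le] at ha hb
  have := Int.eq_zero_of_abs_lt_dvd hab (by rw [abs_lt]; push_cast; omega)
  omega

lemma prod_zmod_eq_prod_Icc {M : Type*} [CommMonoid M] (r : ℕ) (f : ZMod (2 * r + 1) → M) :
    ∏ t, f t = ∏ k ∈ Finset.Icc (-(r : ℤ)) r, f k := by
  refine (Finset.prod_nbij (fun k : ℤ => (k : ZMod (2 * r + 1))) (by simp) ?_ ?_
    (fun _ _ => rfl)).symm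
  · intro a ha b hb hab
    rw [Finset.coe_Icc, Set.mem_Icc] at ha hb
    exact (intCast_zmod_eq_iff (abs_le.2 ha) (abs_le.2 hb)).1 hab
  · intro t _
    refine ⟨t.valMinAbs, ?_, t.coe_valMinAbs⟩
    have := t.natAbs_valMinAbs_le
    rw [Finset.coe_Icc, Set.mem_Icc]
    omega

/-- The Haar trace of a word along a cyclically alternating list of letters. -/
lemma haar_apply_alternating {n : ℕ} (hn : 1 ≤ n) {U : BrownAlg n}
    {F : FreeProd U.carrier U.carrier} {Δ : U.carrier →⋆ₐ[ℂ] F.carrier}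
    (hΔ : U.IsCoprod F Δ) {δc : U.carrier →⋆ₐ[ℂ] ℂ}
    {h : U.carrier →ₗ[ℂ] ℂ} (htrace : IsTracialState h)
    (hHaar : ∀ φ : U.carrier →ₗ[ℂ] ℂ, IsTracialState φ →
        U.TensorConv F Δ δc φ h h ∧ U.TensorConv F Δ δc h φ h)
    (ε : ℕ → Bool) (L : List ℕ) (hL : IsAlternating (L.map ε)) (i j : ℕ → Fin n) :
    h (L.map fun l => if ε l then star (U.u (i l) (j l)) else U.u (i l) (j l)).prod =
      (n : ℂ)⁻¹ * (L.map (letterUnit ε i j)).prod.trace := by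
  obtain ⟨φ, hφ, hφword⟩ := exists_shiftedFlip_state hn U 1
  have hφword' : ∀ r ε i j, φ (genWord U r ε i j).prod =
      (n : ℂ)⁻¹ * ((List.range r).map (letterUnit ε i j)).prod.trace := by
    intro r ε i j
    rw [hφword, if_pos (Subsingleton.elim _ _), Fintype.prod_subsingleton _ 0]
    congr
    exact List.filter_eq_self.2 fun m _ => decide_eq_true (Subsingleton.elim _ _)
  have hget : (List.range L.length).map (fun l => L.getD l 0) = L := by
    refine List.ext_getElem (by simp) fun l h₁ h₂ => ?_
    simp [h₂]
  have hmap : ∀ {γ : Type} (f : ℕ → γ),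
      (List.range L.length).map (fun l => f (L.getD l 0)) = L.map f := by
    intro γ f
    conv_rhs => rw [← hget, List.map_map]
    rfl
  set ε' : ℕ → Bool := fun l => ε (L.getD l 0) with hε'
  have halt : IsAlternating ((List.range L.length).map ε') := by rwa [hmap ε]
  obtain ⟨α, β, hαβ⟩ := exists_trace_prod_letterUnit_eq (n := n) ε' _ halt
  have key := haar_eq_of_product_form hn hΔ htrace hHaar hφ halt.count_eq
    (α := fun i => (n : ℂ)⁻¹ * α i) (β := β) (fun i j => by rw [hφword', hαβ, mul_assoc])
    (fun l => i (L.getD l 0)) (fun l => j (L.getD l 0))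
  rw [hφword'] at key
  rw [← hmap fun l => if ε l then star (U.u (i l) (j l)) else U.u (i l) (j l),
    ← hmap (letterUnit ε i j)]
  exact key

/-- The tensor Haar trace of a word in the generators vanishes if
the numbers of starred and unstarred letters differ, and otherwise factorizes over
the level sets `S_k`. -/
theorem tensor_haar_trace_word_factorization (n : ℕ) (hn : 1 ≤ n) (U : BrownAlg n)
    (F : FreeProd U.carrier U.carrier) (Δ : U.carrier →⋆ₐ[ℂ] F.carrier)
    (hΔ : U.IsCoprod F Δ) (δc : U.carrier →⋆ₐ[ℂ] ℂ) (hδ : U.IsCounit δc)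
    (h : U.carrier →ₗ[ℂ] ℂ) (htrace : IsTracialState h)
    (hHaar : ∀ φ : U.carrier →ₗ[ℂ] ℂ, IsTracialState φ →
        U.TensorConv F Δ δc φ h h ∧ U.TensorConv F Δ δc h φ h)
    (r : ℕ) (hr : 1 ≤ r) (ε : ℕ → Bool) (i j : ℕ → Fin n) :
    (((Finset.range r).filter (fun m => ε m = true)).card ≠
        ((Finset.range r).filter (fun m => ε m = false)).card →
      h (genWord U r ε i j).prod = 0) ∧
    (((Finset.range r).filter (fun m => ε m = true)).card =
        ((Finset.range r).filter (fun m => ε m = false)).card →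
      h (genWord U r ε i j).prod =
        ∏ k ∈ Finset.Icc (-(r : ℤ)) (r : ℤ),
          h ((((levelSet r ε k).sort (· ≤ ·)).map
            (fun l => if ε l then star (U.u (i l) (j l)) else U.u (i l) (j l))).prod)) := by
  obtain ⟨φ, hφ, hφword⟩ := exists_shiftedFlip_state hn U (2 * r + 1)
  have hcard := suffixBalance_eq_card_sub_card ε (Nat.zero_le r)
  rw [Nat.Ico_zero_eq_range] at hcard
  have hzero : (suffixBalance r ε 0 : ZMod (2 * r + 1)) = 0 ↔ suffixBalance r ε 0 = 0 := by
    rw [← Int.cast_zero, intCast_zmod_eq_iff (abs_suffixBalance_zero_le r ε) (by simp)]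
  refine ⟨fun hne => ?_, fun heq => ?_⟩
  · have hsb : suffixBalance r ε 0 ≠ 0 := by omega
    rw [(hHaar φ hφ).1.apply_genWord hΔ hφ.1.1 htrace.1.1 ⟨0, hn⟩]
    refine Finset.sum_eq_zero fun k _ => ?_
    rw [hφword, if_neg (hzero.not.2 hsb), zero_mul]
  · have hsb : suffixBalance r ε 0 = 0 := by omega
    have hφword' : ∀ i j, φ (genWord U r ε i j).prod = ∏ k ∈ Finset.Icc (-(r : ℤ)) r,
        ((n : ℂ)⁻¹ * (((List.range r).filter
          fun m => letterLevel r ε m = k).map (letterUnit ε i j)).prod.trace) := by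
      intro i j
      rw [hφword, if_pos (hzero.2 hsb), prod_zmod_eq_prod_Icc]
      refine Finset.prod_congr rfl fun k hk => ?_
      have hfilter : ((List.range r).filter
          fun m => (letterLevel r ε m : ZMod (2 * r + 1)) = (k : ZMod (2 * r + 1))) =
          (List.range r).filter fun m => letterLevel r ε m = k :=
        List.filter_congr fun m hm => decide_eq_decide.2 <| intCast_zmod_eq_iff
          (abs_letterLevel_le ε (List.mem_range.1 hm)) (abs_le.2 (Finset.mem_Icc.1 hk))
      rw [hfilter]
    choose α β hαβ using fun k =>
      exists_trace_prod_letterUnit_eq (n := n) ε _ (isAlternating_level_filter hsb k)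
    have hcount := count_sub_count_eq_suffixBalance r ε
    rw [haar_eq_of_product_form hn hΔ htrace hHaar hφ (by omega)
      (α := fun i => ∏ k ∈ Finset.Icc (-(r : ℤ)) r, ((n : ℂ)⁻¹ * α k i))
      (β := fun j => ∏ k ∈ Finset.Icc (-(r : ℤ)) r, β k j)
      (fun i j => by simp only [hφword', hαβ, ← Finset.prod_mul_distrib, mul_assoc]), hφword']
    refine Finset.prod_congr rfl fun k _ => ?_
    rw [sort_levelSet, haar_apply_alternating hn hΔ htrace hHaar ε _
      (isAlternating_level_filter hsb k)]
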